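/- For every natural number g ≥ 1 and every integer N ≥ 2, there exist a finite simple graph Λ and a group automorphism φ of the right-angled Artin group A_Λ such that φ has order exactly N (in particular φ^N = id) and the fixed subgroup Fix(φ) is isomorphic to the genus-g surface group. -/

import Mathlib

/-- The relator set of the right-angled Artin group of a simple graph: commutators of
adjacent vertices. -/
def raagRels {V : Type*} (Λ : SimpleGraph V) : Set (FreeGroup V) :=
  {r | ∃ v w : V, Λ.Adj v w ∧
    r = FreeGroup.of v * FreeGroup.of w * (FreeGroup.of v)⁻¹ * (FreeGroup.of w)⁻¹}

/-- The right-angled Artin group of a simple graph. -/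
abbrev RAAG {V : Type*} (Λ : SimpleGraph V) : Type _ := PresentedGroup (raagRels Λ)

/-- The fixed subgroup of a group automorphism. -/
def fixSubgroup {G : Type*} [Group G] (φ : G ≃* G) : Subgroup G where
  carrier := {g | φ g = g}
  one_mem' := map_one φ
  mul_mem' := by
    intro a b ha hb
    simp only [Set.mem_setOf_eq] at *
    rw [map_mul, ha, hb]
  inv_mem' := by
    intro a ha
    simp only [Set.mem_setOf_eq] at *
    rw [map_inv, ha]

/-- The surface relator `[a₁,b₁][a₂,b₂]⋯[a_g,b_g]`, where the generator `a_i` is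
`Sum.inl i` and `b_i` is `Sum.inr i`. -/
def surfaceRel (g : ℕ) : FreeGroup (Fin g ⊕ Fin g) :=
  ((List.finRange g).map fun i =>
    FreeGroup.of (Sum.inl i) * FreeGroup.of (Sum.inr i) *
      (FreeGroup.of (Sum.inl i))⁻¹ * (FreeGroup.of (Sum.inr i))⁻¹).prod

/-- The genus-`g` surface group
`⟨a₁, b₁, …, a_g, b_g ∣ [a₁,b₁][a₂,b₂]⋯[a_g,b_g]⟩`. -/
abbrev SurfaceGroup (g : ℕ) : Type _ :=
  PresentedGroup ({surfaceRel g} : Set (FreeGroup (Fin g ⊕ Fin g)))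

section Presentations

variable {G H : Type*} [Group G] [Group H]

theorem Subgroup.forall_commute_of_closure {s : Set G} {f : G →* H} {c : H}
    (h : ∀ g ∈ s, Commute (f g) c) {g : G} (hg : g ∈ closure s) : Commute (f g) c := by
  induction hg using closure_induction with
  | mem x hx => exact h x hx
  | one => simp
  | mul x y _ _ hx hy => rw [map_mul]; exact hx.mul_left hy
  | inv x _ hx => rw [map_inv]; exact hx.inv_left

/-- To extend homomorphisms to a semidirect product it suffices to check compatibility on
a generating set of the acting group. -/
theorem SemidirectProduct.lift_compatible {N : Type*} [Group N] {θ : G →* MulAut N}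
    {fn : N →* H} {fg : G →* H} {s : Set G} (hs : Subgroup.closure s = ⊤)
    (h : ∀ g ∈ s, ∀ n, fn (θ g n) = fg g * fn n * (fg g)⁻¹) (g : G) :
    fn.comp (θ g).toMonoidHom = (MulAut.conj (fg g)).toMonoidHom.comp fn := by
  suffices key : ∀ n, fn (θ g n) = fg g * fn n * (fg g)⁻¹ by ext n; simpa using key n
  have hg : g ∈ Subgroup.closure s := hs ▸ Subgroup.mem_top g
  induction hg using Subgroup.closure_induction with
  | mem x hx => exact h x hx
  | one => simp
  | mul x y _ _ hx hy => intro n; simp [hx, hy, mul_assoc]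
  | inv x _ hx =>
    intro n
    have := hx ((θ x)⁻¹ n)
    rw [MulAut.apply_inv_self] at this
    rw [map_inv, map_inv, this]
    group

theorem RAAG.commute_of {V : Type*} {Λ : SimpleGraph V} {v w : V} (h : Λ.Adj v w) :
    Commute (PresentedGroup.of v : RAAG Λ) (PresentedGroup.of w) := by
  have h1 := PresentedGroup.one_of_mem (rels := raagRels Λ) ⟨v, w, h, rfl⟩
  simp only [map_mul, map_inv] at h1
  exact eq_of_mul_inv_eq_one (by rw [mul_inv_rev, ← mul_assoc]; exact h1)

/-- The universal property of a right-angled Artin group. -/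
def RAAG.lift {V : Type*} {Λ : SimpleGraph V} (f : V → G)
    (h : ∀ v w, Λ.Adj v w → Commute (f v) (f w)) : RAAG Λ →* G :=
  PresentedGroup.toGroup (f := f) (by
    rintro _ ⟨v, w, hvw, rfl⟩
    simp [(h v w hvw).eq])

@[simp]
theorem RAAG.lift_of {V : Type*} {Λ : SimpleGraph V} (f : V → G)
    (h : ∀ v w, Λ.Adj v w → Commute (f v) (f w)) (v : V) :
    RAAG.lift f h (PresentedGroup.of v) = f v :=
  PresentedGroup.toGroup.of _

/-- Isomorphic graphs have isomorphic right-angled Artin groups. -/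
def RAAG.congr {V W : Type*} {Λ : SimpleGraph V} {Δ : SimpleGraph W} (e : Λ ≃g Δ) :
    RAAG Λ ≃* RAAG Δ :=
  MonoidHom.toMulEquiv
    (RAAG.lift (fun v => PresentedGroup.of (e v)) fun _ _ h =>
      RAAG.commute_of (e.map_adj_iff.2 h))
    (RAAG.lift (fun v => PresentedGroup.of (e.symm v)) fun _ _ h =>
      RAAG.commute_of (e.symm.map_adj_iff.2 h))
    (PresentedGroup.ext fun v => by simp)
    (PresentedGroup.ext fun v => by simp)

end Presentations

theorem FreeGroup.eq_one_of_map_eq_self {ι : Type*} {p : ι → ι} (hp : ∀ i, p i ≠ i)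
    {w : FreeGroup ι} (hw : FreeGroup.map p w = w) : w = 1 := by
  classical
  have h1 : FreeGroup.mk (w.toWord.map fun x => (p x.1, x.2)) = w := by
    rw [← FreeGroup.map.mk, FreeGroup.mk_toWord, hw]
  have h2 : FreeGroup.Red (w.toWord.map fun x => (p x.1, x.2)) w.toWord := by
    have := FreeGroup.reduce.red (L := w.toWord.map fun x => (p x.1, x.2))
    rwa [← FreeGroup.toWord_mk, h1] at this
  have h3 := h2.sublist.eq_of_length (by simp)
  rw [← FreeGroup.toWord_eq_nil_iff]
  match hl : w.toWord with
  | [] => rfl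
  | a :: l =>
    rw [hl, List.map_cons, List.cons.injEq] at h3
    exact absurd (congrArg Prod.fst h3.1).symm (hp a.1)

/-- The permutation action of `M` on `(M ⧸ L) × I`, trivial on the second factor, extended to
the free group. -/
def cosetFreeAction {M : Type*} [Group M] (L : Subgroup M) (I : Type*) :
    M →* MulAut (FreeGroup ((M ⧸ L) × I)) where
  toFun m := FreeGroup.freeGroupCongr ((MulAction.toPerm m).prodCongr (Equiv.refl I))
  map_one' := by
    refine MulEquiv.toMonoidHom_injective (FreeGroup.ext_hom _ _ fun x => ?_)
    simp [Prod.map]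
  map_mul' a b := by
    refine MulEquiv.toMonoidHom_injective (FreeGroup.ext_hom _ _ fun x => ?_)
    simp [Prod.map, mul_smul]

/-- The group obtained from `M` by freely adjoining a family of elements indexed by `I`
that centralize `L`, written as a semidirect product. -/
abbrev CentralizingExt {M : Type*} [Group M] (L : Subgroup M) (I : Type*) : Type _ :=
  FreeGroup ((M ⧸ L) × I) ⋊[cosetFreeAction L I] M

namespace CentralizingExt

open SemidirectProduct

variable {M H I : Type*} [Group M] [Group H] {L : Subgroup M}

/-- The adjoined elements. -/
def gen (L : Subgroup M) (j : I) : CentralizingExt L I :=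
  inl (FreeGroup.of ((1 : M), j))

theorem conj_gen (m : M) (j : I) :
    (inr m * gen L j * (inr m)⁻¹ : CentralizingExt L I) = inl (FreeGroup.of ((m : M ⧸ L), j)) := by
  rw [gen, ← map_inv, ← inl_aut]
  congr 1
  simp [cosetFreeAction]

theorem commute_gen {l : M} (hl : l ∈ L) (j : I) :
    Commute (inr l : CentralizingExt L I) (gen L j) := by
  refine eq_mul_of_mul_inv_eq ?_
  rw [conj_gen, gen]
  have : (l : M ⧸ L) = ((1 : M) : M ⧸ L) := by rw [QuotientGroup.eq]; simpa using hl
  rw [this]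

/-- The conjugates of the elements `c j` by representatives of the cosets of `L`. -/
def cosetConj (f : M →* H) (c : I → H) (h : ∀ l ∈ L, ∀ j, Commute (f l) (c j))
    (x : (M ⧸ L) × I) : H :=
  Quotient.liftOn' x.1 (fun m => f m * c x.2 * (f m)⁻¹) (by
    intro a b hab
    have := h _ (QuotientGroup.leftRel_apply.1 hab) x.2
    have hb : f b = f a * f (a⁻¹ * b) := by simp
    simp only [hb, mul_inv_rev, mul_assoc, mul_right_inj]
    rw [← mul_assoc (f _) (c x.2), this.eq]
    simp [mul_assoc])

theorem cosetConj_mk (f : M →* H) (c : I → H) (h : ∀ l ∈ L, ∀ j, Commute (f l) (c j))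
    (m : M) (j : I) : cosetConj f c h ((m : M ⧸ L), j) = f m * c j * (f m)⁻¹ :=
  rfl

/-- The universal property of `CentralizingExt`. -/
def lift (f : M →* H) (c : I → H) (h : ∀ l ∈ L, ∀ j, Commute (f l) (c j)) :
    CentralizingExt L I →* H :=
  SemidirectProduct.lift (FreeGroup.lift (cosetConj f c h)) f (by
    intro m
    refine FreeGroup.ext_hom _ _ ?_
    rintro ⟨q, j⟩
    induction q using QuotientGroup.induction_on with
    | H a =>
      simp [cosetFreeAction, cosetConj_mk, mul_assoc])

@[simp]
theorem lift_inr (f : M →* H) (c : I → H) (h : ∀ l ∈ L, ∀ j, Commute (f l) (c j)) (m : M) :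
    lift f c h (inr m) = f m := by simp [lift]

@[simp]
theorem lift_gen (f : M →* H) (c : I → H) (h : ∀ l ∈ L, ∀ j, Commute (f l) (c j)) (j : I) :
    lift f c h (gen L j) = c j := by
  simp only [lift, gen, SemidirectProduct.lift_inl, FreeGroup.lift_apply_of]
  exact (cosetConj_mk f c h 1 j).trans (by simp)

/-- An endomorphism that permutes the adjoined elements without fixed points fixes
nothing outside the base group. -/
theorem exists_of_fixed (F : CentralizingExt L I →* CentralizingExt L I) {φ : M →* M}
    (hL : ∀ l ∈ L, φ l ∈ L) {p : I → I} (hp : ∀ j, p j ≠ j)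
    (hinr : ∀ m, F (inr m) = inr (φ m)) (hgen : ∀ j, F (gen L j) = gen L (p j))
    {e : CentralizingExt L I} (he : F e = e) : ∃ m, φ m = m ∧ e = inr m := by
  let q : (M ⧸ L) × I → (M ⧸ L) × I := fun x =>
    (Quotient.map' φ (fun a b hab => by
      rw [QuotientGroup.leftRel_apply] at hab ⊢
      simpa using hL _ hab) x.1, p x.2)
  have hinl : ∀ n, F (inl n) = inl (FreeGroup.map q n) := by
    suffices F.comp inl = inl.comp (FreeGroup.map q) from fun n => DFunLike.congr_fun this n
    refine FreeGroup.ext_hom _ _ ?_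
    rintro ⟨c, j⟩
    induction c using QuotientGroup.induction_on with
    | H a =>
      simp only [MonoidHom.comp_apply, FreeGroup.map.of]
      rw [← conj_gen, map_mul, map_mul, map_inv, hinr, hgen, conj_gen]
      rfl
  rw [← inl_left_mul_inr_right e, map_mul, hinl, hinr] at he
  have h1 := congrArg SemidirectProduct.left he
  have h2 := congrArg SemidirectProduct.right he
  simp at h1 h2
  have h3 := FreeGroup.eq_one_of_map_eq_self (p := q) (fun i h => hp i.2 (congrArg Prod.snd h)) h1
  exact ⟨e.right, h2, by rw [← inl_left_mul_inr_right e, h3]; simp⟩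

end CentralizingExt

/-- The free abelian group of rank two, as a right-angled Artin group. -/
abbrev RankTwo : Type := RAAG (⊤ : SimpleGraph Bool)

namespace RankTwo

variable {G : Type*} [Group G]

/-- The first generator. -/
def fst : RankTwo := PresentedGroup.of false

/-- The second generator. -/
def snd : RankTwo := PresentedGroup.of true

theorem commute_fst_snd : Commute fst snd := RAAG.commute_of (by simp)

theorem closure_eq_top : Subgroup.closure {fst, snd} = ⊤ := by
  rw [← PresentedGroup.closure_range_of]
  congr 1
  ext x
  simp [fst, snd]

/-- The homomorphism determined by a commuting pair. -/
def lift {p q : G} (h : Commute p q) : RankTwo →* G :=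
  RAAG.lift (fun b => cond b q p) (by
    rintro (_ | _) (_ | _) _
    exacts [.refl _, h, h.symm, .refl _])

@[simp]
theorem lift_fst {p q : G} (h : Commute p q) : lift h fst = p := by simp [lift, fst]

@[simp]
theorem lift_snd {p q : G} (h : Commute p q) : lift h snd = q := by simp [lift, snd]

theorem hom_ext {f g : RankTwo →* G} (h₁ : f fst = g fst) (h₂ : f snd = g snd) : f = g :=
  PresentedGroup.ext (by rintro (_ | _) <;> assumption)

end RankTwo

/-- Generators of `PolygonGroup`. -/
inductive PolygonGen (ι : Type*)
  | x (i : ι)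
  | x' (i : ι)
  | y (i : ι)
  | y' (i : ι)

/-- The relators of `PolygonGroup`. -/
def polygonRels {ι : Type*} (P : ι → ι → Prop) (o : ι) : Set (FreeGroup (PolygonGen ι)) :=
  {r | ∃ i j, P i j ∧ r = FreeGroup.of (.x i) * FreeGroup.of (.y' j) *
      (FreeGroup.of (.x' i))⁻¹ * (FreeGroup.of (.y j))⁻¹} ∪
    FreeGroup.of '' {.x o, .x' o, .y o, .y' o}

/-- A presentation of the kernel of the map from the right-angled Coxeter group of a bipartite
graph to `(ℤ/2)²` given by the two colors. The adjacency between the colors is `P`, and `o` is the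
base vertex in each color. With `r i` and `b i` the reflections of the two colors, `x i`, `y i` are
`r i * r o`, `b i * b o`, and `x' i`, `y' i` are their conjugates by `b o`, `r o`. -/
abbrev PolygonGroup {ι : Type*} (P : ι → ι → Prop) (o : ι) : Type _ :=
  PresentedGroup (polygonRels P o)

namespace PolygonGroup

variable {G ι : Type*} [Group G] (P : ι → ι → Prop) (o : ι)

/-- The family of generators `x`. -/
def x (i : ι) : PolygonGroup P o := PresentedGroup.of (.x i)

/-- The family of generators `x'`. -/
def x' (i : ι) : PolygonGroup P o := PresentedGroup.of (.x' i)

/-- The family of generators `y`. -/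
def y (i : ι) : PolygonGroup P o := PresentedGroup.of (.y i)

/-- The family of generators `y'`. -/
def y' (i : ι) : PolygonGroup P o := PresentedGroup.of (.y' i)

@[simp]
theorem x_base : x P o o = 1 := PresentedGroup.one_of_mem (.inr ⟨_, by simp, rfl⟩)

@[simp]
theorem x'_base : x' P o o = 1 := PresentedGroup.one_of_mem (.inr ⟨_, by simp, rfl⟩)

@[simp]
theorem y_base : y P o o = 1 := PresentedGroup.one_of_mem (.inr ⟨_, by simp, rfl⟩)

@[simp]
theorem y'_base : y' P o o = 1 := PresentedGroup.one_of_mem (.inr ⟨_, by simp, rfl⟩)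

variable {P o}

theorem relation {i j : ι} (h : P i j) : x P o i * y' P o j = y P o j * x' P o i := by
  have h1 := PresentedGroup.one_of_mem (rels := polygonRels P o) (.inl ⟨i, j, h, rfl⟩)
  simp only [map_mul, map_inv] at h1
  exact eq_of_mul_inv_eq_one (by rw [mul_inv_rev, ← mul_assoc]; exact h1)

variable (P o G) in
/-- Families of elements satisfying the relations of `PolygonGroup`. -/
structure Rep where
  /-- The images of the generators `x`. -/
  x : ι → G
  /-- The images of the generators `x'`. -/
  x' : ι → G
  /-- The images of the generators `y`. -/
  y : ι → G
  /-- The images of the generators `y'`. -/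
  y' : ι → G
  x_base : x o = 1
  x'_base : x' o = 1
  y_base : y o = 1
  y'_base : y' o = 1
  relation : ∀ i j, P i j → x i * y' j = y j * x' i

/-- The images of the generators in a representation. -/
def Rep.onGen (ρ : Rep G P o) : PolygonGen ι → G
  | .x i => ρ.x i
  | .x' i => ρ.x' i
  | .y i => ρ.y i
  | .y' i => ρ.y' i

/-- The universal property of `PolygonGroup`. -/
def lift (ρ : Rep G P o) : PolygonGroup P o →* G :=
  PresentedGroup.toGroup (f := ρ.onGen) (by
    rintro _ (⟨i, j, h, rfl⟩ | ⟨_, (rfl | rfl | rfl | rfl), rfl⟩)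
    · simp [Rep.onGen, ρ.relation i j h]
    · simpa [Rep.onGen] using ρ.x_base
    · simpa [Rep.onGen] using ρ.x'_base
    · simpa [Rep.onGen] using ρ.y_base
    · simpa [Rep.onGen] using ρ.y'_base)

@[simp]
theorem lift_x (ρ : Rep G P o) (i : ι) : lift ρ (x P o i) = ρ.x i := PresentedGroup.toGroup.of _

@[simp]
theorem lift_x' (ρ : Rep G P o) (i : ι) : lift ρ (x' P o i) = ρ.x' i :=
  PresentedGroup.toGroup.of _

@[simp]
theorem lift_y (ρ : Rep G P o) (i : ι) : lift ρ (y P o i) = ρ.y i := PresentedGroup.toGroup.of _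

@[simp]
theorem lift_y' (ρ : Rep G P o) (i : ι) : lift ρ (y' P o i) = ρ.y' i :=
  PresentedGroup.toGroup.of _

theorem hom_ext {f g : PolygonGroup P o →* G} (hx : ∀ i, f (x P o i) = g (x P o i))
    (hx' : ∀ i, f (x' P o i) = g (x' P o i)) (hy : ∀ i, f (y P o i) = g (y P o i))
    (hy' : ∀ i, f (y' P o i) = g (y' P o i)) : f = g :=
  PresentedGroup.ext (by
    rintro (i | i | i | i)
    exacts [hx i, hx' i, hy i, hy' i])

variable (P o)

/-- Conjugation by the base reflection of the first color. -/
def flipX : MulAut (PolygonGroup P o) :=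
  let f : PolygonGroup P o →* PolygonGroup P o := lift
    { x := fun i => (x P o i)⁻¹
      x' := fun i => (x' P o i)⁻¹
      y := y' P o
      y' := y P o
      x_base := by simp
      x'_base := by simp
      y_base := by simp
      y'_base := by simp
      relation := fun i j h => by
        rw [inv_mul_eq_iff_eq_mul, ← mul_assoc, relation h]; simp }
  have hf : f.comp f = MonoidHom.id _ := hom_ext (by simp [f]) (by simp [f]) (by simp [f])
    (by simp [f])
  f.toMulEquiv f hf hf

/-- Conjugation by the base reflection of the second color. -/
def flipY : MulAut (PolygonGroup P o) :=
  let f : PolygonGroup P o →* PolygonGroup P o := lift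
    { x := x' P o
      x' := x P o
      y := fun i => (y P o i)⁻¹
      y' := fun i => (y' P o i)⁻¹
      x_base := by simp
      x'_base := by simp
      y_base := by simp
      y'_base := by simp
      relation := fun i j h => by
        rw [mul_inv_eq_iff_eq_mul, mul_assoc, relation h]; simp }
  have hf : f.comp f = MonoidHom.id _ := hom_ext (by simp [f]) (by simp [f]) (by simp [f])
    (by simp [f])
  f.toMulEquiv f hf hf

@[simp]
theorem flipX_x (i : ι) : flipX P o (x P o i) = (x P o i)⁻¹ := by
  simp [flipX]

@[simp]
theorem flipX_x' (i : ι) : flipX P o (x' P o i) = (x' P o i)⁻¹ := by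
  simp [flipX]

@[simp]
theorem flipX_y (i : ι) : flipX P o (y P o i) = y' P o i := by
  simp [flipX]

@[simp]
theorem flipX_y' (i : ι) : flipX P o (y' P o i) = y P o i := by
  simp [flipX]

@[simp]
theorem flipY_x (i : ι) : flipY P o (x P o i) = x' P o i := by
  simp [flipY]

@[simp]
theorem flipY_x' (i : ι) : flipY P o (x' P o i) = x P o i := by
  simp [flipY]

@[simp]
theorem flipY_y (i : ι) : flipY P o (y P o i) = (y P o i)⁻¹ := by
  simp [flipY]

@[simp]
theorem flipY_y' (i : ι) : flipY P o (y' P o i) = (y' P o i)⁻¹ := by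
  simp [flipY]

@[simp]
theorem flipX_symm : (flipX P o).symm = flipX P o := rfl

@[simp]
theorem flipY_symm : (flipY P o).symm = flipY P o := rfl

theorem commute_flips : Commute (flipX P o) (flipY P o) :=
  MulEquiv.toMonoidHom_injective (hom_ext (by simp) (by simp) (by simp) (by simp))

/-- The action of the base reflections. -/
def flipAction : RankTwo →* MulAut (PolygonGroup P o) := RankTwo.lift (commute_flips P o)

@[simp]
theorem flipAction_fst : flipAction P o .fst = flipX P o := RankTwo.lift_fst _

@[simp]
theorem flipAction_snd : flipAction P o .snd = flipY P o := RankTwo.lift_snd _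

/-- The extension of `PolygonGroup` by its base reflections. -/
abbrev Reflected : Type _ := PolygonGroup P o ⋊[flipAction P o] RankTwo

/-- The reflections of the first color. -/
def red (i : ι) : Reflected P o := SemidirectProduct.inl (x P o i) * SemidirectProduct.inr .fst

/-- The reflections of the second color. -/
def blue (i : ι) : Reflected P o := SemidirectProduct.inl (y P o i) * SemidirectProduct.inr .snd

variable {P o}

theorem commute_red_blue {i j : ι} (h : P i j) : Commute (red P o i) (blue P o j) := by
  refine SemidirectProduct.ext ?_ ?_
  · simp [red, blue, relation h]
  · exact RankTwo.commute_fst_snd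

end PolygonGroup

/-- Vertices of the defining graph of `ShiftArtin`: two families indexed by `ι`, and two families
indexed by the nonzero elements of `I`. -/
abbrev ShiftVertex (ι I : Type*) [Zero I] : Type _ :=
  (ι ⊕ ι) ⊕ ({k : I // k ≠ 0} ⊕ {k : I // k ≠ 0})

/-- Adjacency from the first color to the second color. -/
def ShiftVertex.Rel {ι I : Type*} [Zero I] (P : ι → ι → Prop) :
    ShiftVertex ι I → ShiftVertex ι I → Prop
  | .inl (.inl i), .inl (.inr j) => P i j
  | .inl (.inl _), .inr (.inr _) => True
  | .inr (.inl _), .inl (.inr _) => True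
  | .inr (.inl _), .inr (.inr _) => True
  | _, _ => False

/-- The right-angled Artin group of the bipartite graph in which the first color consists of
vertices `x i` and `s k`, the second of vertices `y i` and `t k`, with `x i` adjacent to `y j` when
`P i j`, and all other pairs of vertices of different colors adjacent. -/
abbrev ShiftArtin {ι : Type*} (P : ι → ι → Prop) (I : Type*) [Zero I] : Type _ :=
  RAAG (SimpleGraph.fromRel (ShiftVertex.Rel (I := I) P))

namespace ShiftArtin

section Zero

open scoped Classical in
/-- Extend a family indexed by nonzero elements by the value `1` at zero. -/
noncomputable def extendOne {G I : Type*} [Group G] [Zero I] (f : {k : I // k ≠ 0} → G) (k : I) :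
    G :=
  if h : k = 0 then 1 else f ⟨k, h⟩

variable {G ι I : Type*} [Group G] [Zero I] (P : ι → ι → Prop)

/-- The generators `x`. -/
def x (I : Type*) [Zero I] (i : ι) : ShiftArtin P I := PresentedGroup.of (.inl (.inl i))

/-- The generators `y`. -/
def y (I : Type*) [Zero I] (i : ι) : ShiftArtin P I := PresentedGroup.of (.inl (.inr i))

/-- The generators `s`, extended by `s 0 = 1`. -/
noncomputable def s (k : I) : ShiftArtin P I :=
  extendOne (fun k => PresentedGroup.of (.inr (.inl k))) k

/-- The generators `t`, extended by `t 0 = 1`. -/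
noncomputable def t (k : I) : ShiftArtin P I :=
  extendOne (fun k => PresentedGroup.of (.inr (.inr k))) k

@[simp]
theorem s_zero : s P (0 : I) = 1 := by simp [s, extendOne]

@[simp]
theorem t_zero : t P (0 : I) = 1 := by simp [t, extendOne]

theorem s_of_ne (k : {k : I // k ≠ 0}) : s P (k : I) = PresentedGroup.of (.inr (.inl k)) := by
  simp [s, extendOne, k.2]

theorem t_of_ne (k : {k : I // k ≠ 0}) : t P (k : I) = PresentedGroup.of (.inr (.inr k)) := by
  simp [t, extendOne, k.2]

variable {P}

theorem commute_xy {i j : ι} (h : P i j) : Commute (x P I i) (y P I j) :=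
  RAAG.commute_of (by simp [ShiftVertex.Rel, h])

theorem commute_xt (i : ι) (l : I) : Commute (x P I i) (t P l) := by
  by_cases hl : l = 0
  · simp [hl]
  · rw [t_of_ne P ⟨l, hl⟩]
    exact RAAG.commute_of (by simp [ShiftVertex.Rel])

theorem commute_sy (k : I) (j : ι) : Commute (s P k) (y P I j) := by
  by_cases hk : k = 0
  · simp [hk]
  · rw [s_of_ne P ⟨k, hk⟩]
    exact RAAG.commute_of (by simp [ShiftVertex.Rel])

theorem commute_st (k l : I) : Commute (s P k) (t P l) := by
  by_cases hk : k = 0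
  · simp [hk]
  by_cases hl : l = 0
  · simp [hl]
  rw [s_of_ne P ⟨k, hk⟩, t_of_ne P ⟨l, hl⟩]
  exact RAAG.commute_of (by simp [ShiftVertex.Rel])

variable (G I P) in
/-- Families of elements satisfying the relations of `ShiftArtin`. -/
structure Rep where
  /-- The images of the generators `x`. -/
  x : ι → G
  /-- The images of the generators `y`. -/
  y : ι → G
  /-- The images of the generators `s`. -/
  s : I → G
  /-- The images of the generators `t`. -/
  t : I → G
  s_zero : s 0 = 1
  t_zero : t 0 = 1
  commute_xy : ∀ i j, P i j → Commute (x i) (y j)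
  commute_xt : ∀ i l, Commute (x i) (t l)
  commute_sy : ∀ k j, Commute (s k) (y j)
  commute_st : ∀ k l, Commute (s k) (t l)

/-- The images of the vertices in a representation. -/
def Rep.onVertex (ρ : Rep G I P) : ShiftVertex ι I → G
  | .inl (.inl i) => ρ.x i
  | .inl (.inr i) => ρ.y i
  | .inr (.inl k) => ρ.s k
  | .inr (.inr k) => ρ.t k

theorem Rep.commute_of_rel (ρ : Rep G I P) {v w : ShiftVertex ι I} (h : ShiftVertex.Rel P v w) :
    Commute (ρ.onVertex v) (ρ.onVertex w) := by
  rcases v with (i | i) | (i | i) <;> rcases w with (j | j) | (j | j) <;>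
    first
    | exact h.elim
    | exact ρ.commute_xy i j h
    | exact ρ.commute_xt i j
    | exact ρ.commute_sy i j
    | exact ρ.commute_st i j

/-- The universal property of `ShiftArtin`. -/
def lift (ρ : Rep G I P) : ShiftArtin P I →* G :=
  RAAG.lift ρ.onVertex fun _ _ h => by
    obtain ⟨_, h | h⟩ := (SimpleGraph.fromRel_adj _ _ _).1 h
    exacts [ρ.commute_of_rel h, (ρ.commute_of_rel h).symm]

@[simp]
theorem lift_x (ρ : Rep G I P) (i : ι) : lift ρ (x P I i) = ρ.x i := RAAG.lift_of _ _ _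

@[simp]
theorem lift_y (ρ : Rep G I P) (i : ι) : lift ρ (y P I i) = ρ.y i := RAAG.lift_of _ _ _

@[simp]
theorem lift_s (ρ : Rep G I P) (k : I) : lift ρ (s P k) = ρ.s k := by
  by_cases hk : k = 0
  · simp [hk, ρ.s_zero]
  · rw [s_of_ne P ⟨k, hk⟩]
    exact RAAG.lift_of _ _ _

@[simp]
theorem lift_t (ρ : Rep G I P) (k : I) : lift ρ (t P k) = ρ.t k := by
  by_cases hk : k = 0
  · simp [hk, ρ.t_zero]
  · rw [t_of_ne P ⟨k, hk⟩]
    exact RAAG.lift_of _ _ _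

theorem hom_ext {f g : ShiftArtin P I →* G} (hx : ∀ i, f (x P I i) = g (x P I i))
    (hy : ∀ i, f (y P I i) = g (y P I i)) (hs : ∀ k, f (s P k) = g (s P k))
    (ht : ∀ k, f (t P k) = g (t P k)) : f = g :=
  PresentedGroup.ext (by
    rintro ((i | i) | (k | k))
    exacts [hx i, hy i, by simpa [s_of_ne] using hs k, by simpa [t_of_ne] using ht k])

variable (P I)

/-- The inversion of all generators of the first color. -/
noncomputable def invFst : MulAut (ShiftArtin P I) :=
  let f : ShiftArtin P I →* ShiftArtin P I := lift
    { x := fun i => (x P I i)⁻¹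
      y := y P I
      s := fun k => (s P k)⁻¹
      t := t P
      s_zero := by simp
      t_zero := by simp
      commute_xy := fun _ _ h => (commute_xy h).inv_left
      commute_xt := fun _ _ => (commute_xt _ _).inv_left
      commute_sy := fun _ _ => (commute_sy _ _).inv_left
      commute_st := fun _ _ => (commute_st _ _).inv_left }
  have hf : f.comp f = MonoidHom.id _ := hom_ext (by simp [f]) (by simp [f]) (by simp [f])
    (by simp [f])
  f.toMulEquiv f hf hf

/-- The inversion of all generators of the second color. -/
noncomputable def invSnd : MulAut (ShiftArtin P I) :=
  let f : ShiftArtin P I →* ShiftArtin P I := lift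
    { x := x P I
      y := fun i => (y P I i)⁻¹
      s := s P
      t := fun k => (t P k)⁻¹
      s_zero := by simp
      t_zero := by simp
      commute_xy := fun _ _ h => (commute_xy h).inv_right
      commute_xt := fun _ _ => (commute_xt _ _).inv_right
      commute_sy := fun _ _ => (commute_sy _ _).inv_right
      commute_st := fun _ _ => (commute_st _ _).inv_right }
  have hf : f.comp f = MonoidHom.id _ := hom_ext (by simp [f]) (by simp [f]) (by simp [f])
    (by simp [f])
  f.toMulEquiv f hf hf

@[simp]
theorem invFst_x (i : ι) : invFst I P (x P I i) = (x P I i)⁻¹ := by simp [invFst]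

@[simp]
theorem invFst_y (i : ι) : invFst I P (y P I i) = y P I i := by simp [invFst]

@[simp]
theorem invFst_s (k : I) : invFst I P (s P k) = (s P k)⁻¹ := by simp [invFst]

@[simp]
theorem invFst_t (k : I) : invFst I P (t P k) = t P k := by simp [invFst]

@[simp]
theorem invSnd_x (i : ι) : invSnd I P (x P I i) = x P I i := by simp [invSnd]

@[simp]
theorem invSnd_y (i : ι) : invSnd I P (y P I i) = (y P I i)⁻¹ := by simp [invSnd]

@[simp]
theorem invSnd_s (k : I) : invSnd I P (s P k) = s P k := by simp [invSnd]

@[simp]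
theorem invSnd_t (k : I) : invSnd I P (t P k) = (t P k)⁻¹ := by simp [invSnd]

theorem commute_inversions : Commute (invFst I P) (invSnd I P) :=
  MulEquiv.toMonoidHom_injective (hom_ext (by simp) (by simp) (by simp) (by simp))

/-- The action of the inversions of the two colors. -/
noncomputable def invAction : RankTwo →* MulAut (ShiftArtin P I) :=
  RankTwo.lift (commute_inversions I P)

@[simp]
theorem invAction_fst : invAction I P .fst = invFst I P := RankTwo.lift_fst _

@[simp]
theorem invAction_snd : invAction I P .snd = invSnd I P := RankTwo.lift_snd _

end Zero

section Rotation

variable {ι I : Type*} [AddGroup I] (P : ι → ι → Prop)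

/-- The endomorphism that translates the indices of `s` and `t` by `c` and renormalizes so that
`s 0` and `t 0` remain trivial. -/
noncomputable def rotHom (c : I) : ShiftArtin P I →* ShiftArtin P I := lift
  { x := fun i => (s P c)⁻¹ * x P I i
    y := fun i => (t P c)⁻¹ * y P I i
    s := fun k => (s P c)⁻¹ * s P (c + k)
    t := fun k => (t P c)⁻¹ * t P (c + k)
    s_zero := by simp
    t_zero := by simp
    commute_xy := fun _ _ h => ((commute_st _ _).inv_inv.mul_right (commute_sy _ _).inv_left).mul_left
      ((commute_xt _ _).inv_right.mul_right (commute_xy h))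
    commute_xt := fun _ _ => ((commute_st _ _).inv_inv.mul_right (commute_st _ _).inv_left).mul_left
      ((commute_xt _ _).inv_right.mul_right (commute_xt _ _))
    commute_sy := fun _ _ => ((commute_st _ _).inv_inv.mul_right (commute_sy _ _).inv_left).mul_left
      ((commute_st _ _).inv_right.mul_right (commute_sy _ _))
    commute_st := fun _ _ => ((commute_st _ _).inv_inv.mul_right (commute_st _ _).inv_left).mul_left
      ((commute_st _ _).inv_right.mul_right (commute_st _ _)) }

@[simp]
theorem rotHom_x (c : I) (i : ι) : rotHom P c (x P I i) = (s P c)⁻¹ * x P I i := by simp [rotHom]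

@[simp]
theorem rotHom_y (c : I) (i : ι) : rotHom P c (y P I i) = (t P c)⁻¹ * y P I i := by simp [rotHom]

@[simp]
theorem rotHom_s (c k : I) : rotHom P c (s P k) = (s P c)⁻¹ * s P (c + k) := by simp [rotHom]

@[simp]
theorem rotHom_t (c k : I) : rotHom P c (t P k) = (t P c)⁻¹ * t P (c + k) := by simp [rotHom]

theorem rotHom_zero : rotHom P (0 : I) = MonoidHom.id _ :=
  hom_ext (by simp) (by simp) (by simp) (by simp)

theorem rotHom_add (c d : I) : rotHom P (c + d) = (rotHom P c).comp (rotHom P d) :=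
  hom_ext (by simp) (by simp) (by simp [add_assoc]) (by simp [add_assoc])

/-- The action of `I` on `ShiftArtin P I` by rotations. -/
noncomputable def rot : Multiplicative I →* MulAut (ShiftArtin P I) where
  toFun c := (rotHom P c.toAdd).toMulEquiv (rotHom P (-c.toAdd))
    (by rw [← rotHom_add, neg_add_cancel, rotHom_zero])
    (by rw [← rotHom_add, add_neg_cancel, rotHom_zero])
  map_one' := MulEquiv.toMonoidHom_injective (rotHom_zero P)
  map_mul' c d := MulEquiv.toMonoidHom_injective (rotHom_add P c.toAdd d.toAdd)

theorem rot_apply (c : Multiplicative I) (a : ShiftArtin P I) : rot P c a = rotHom P c.toAdd a :=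
  rfl

open scoped Classical in
theorem s_ne_one {c : I} (hc : c ≠ 0) : s P c ≠ 1 := by
  intro h
  let f : ShiftArtin P I →* Multiplicative ℤ := lift
    { x := fun _ => 1
      y := fun _ => 1
      s := fun k => if k = 0 then 1 else .ofAdd 1
      t := fun _ => 1
      s_zero := by simp
      t_zero := by simp
      commute_xy := fun _ _ _ => .all _ _
      commute_xt := fun _ _ => .all _ _
      commute_sy := fun _ _ => .all _ _
      commute_st := fun _ _ => .all _ _ }
  have := congrArg f h
  simp [f, hc] at this

theorem rot_injective [Nonempty ι] : Function.Injective (rot (I := I) P) := by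
  rw [injective_iff_map_eq_one]
  intro c hc
  by_contra hne
  obtain ⟨i⟩ := ‹Nonempty ι›
  have := DFunLike.congr_fun hc (x P I i)
  rw [rot_apply, rotHom_x] at this
  simp only [MulAut.one_apply, mul_eq_right, inv_eq_one] at this
  exact s_ne_one P (c := c.toAdd) hne this

end Rotation

end ShiftArtin

namespace ShiftArtin

open SemidirectProduct PolygonGroup

variable {ι I : Type*} {P : ι → ι → Prop} {o : ι}

section Embedding

variable [Zero I]

/-- The homomorphism identifying `PolygonGroup` with the fixed subgroup of a rotation. -/
def ofPolygon (I : Type*) [Zero I] (ho : P o o) : PolygonGroup P o →* ShiftArtin P I :=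
  PolygonGroup.lift
    { x := fun i => (x P I i)⁻¹ * x P I o
      x' := fun i => (y P I o)⁻¹ * ((x P I i)⁻¹ * x P I o) * y P I o
      y := fun i => (y P I i)⁻¹ * y P I o
      y' := fun i => (x P I o)⁻¹ * ((y P I i)⁻¹ * y P I o) * x P I o
      x_base := by simp
      x'_base := by simp
      y_base := by simp
      y'_base := by simp
      relation := fun i j h => by
        have h1 := (commute_xy (I := I) h).inv_inv.eq
        have h2 := (commute_xy (I := I) ho).eq
        calc _ = ((x P I i)⁻¹ * (y P I j)⁻¹) * (y P I o * x P I o) := by group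
          _ = _ := by rw [h1, ← h2]; group }

/-- The action of the base reflections on `ShiftArtin` extends it to a group in which the
inclusion of `PolygonGroup` extends to `Reflected`. -/
abbrev Inverted (P : ι → ι → Prop) (I : Type*) [Zero I] : Type _ :=
  ShiftArtin P I ⋊[invAction I P] RankTwo

theorem conj_fst (a : ShiftArtin P I) :
    (inr .fst * inl a : Inverted P I) = inl (invFst I P a) * inr .fst := by
  rw [← invAction_fst, inl_aut]; simp

theorem conj_snd (a : ShiftArtin P I) :
    (inr .snd * inl a : Inverted P I) = inl (invSnd I P a) * inr .snd := by
  rw [← invAction_snd, inl_aut]; simp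

theorem commute_inr_mul_inl {a b : ShiftArtin P I} (h : Commute a b)
    (ha : invSnd I P a = a) (hb : invFst I P b = b) :
    Commute (inr .fst * inl a : Inverted P I) (inr .snd * inl b) := by
  have h1 := congrArg (inr : _ →* Inverted P I) RankTwo.commute_fst_snd.eq
  have h2 := conj_snd a
  have h3 := conj_fst b
  rw [map_mul, map_mul] at h1
  have h4 := congrArg (inl : _ →* Inverted P I) h.eq
  rw [map_mul, map_mul] at h4
  rw [ha] at h2
  rw [hb] at h3
  change _ * _ = _ * _
  rw [← mul_assoc, mul_assoc (inr _), ← h2, ← mul_assoc, h1, mul_assoc, h4, mul_assoc,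
    ← mul_assoc (inr RankTwo.fst), h3]
  simp only [mul_assoc]

theorem ofPolygon_flipX (ho : P o o) (n : PolygonGroup P o) :
    ofPolygon I ho (flipX P o n) =
      invFst I P (x P I o * ofPolygon I ho n * (x P I o)⁻¹) := by
  suffices (ofPolygon I ho).comp (flipX P o).toMonoidHom = (invFst I P).toMonoidHom.comp
      ((MulAut.conj (x P I o)).toMonoidHom.comp (ofPolygon I ho)) from DFunLike.congr_fun this n
  have h := (commute_xy (I := I) ho)
  refine PolygonGroup.hom_ext ?_ ?_ ?_ ?_ <;> intro i
  · simp [ofPolygon, mul_assoc]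
  · have h1 : (x P I o)⁻¹ * (y P I o)⁻¹ = (y P I o)⁻¹ * (x P I o)⁻¹ := h.inv_inv.eq
    calc _ = (y P I o)⁻¹ * (x P I o)⁻¹ * (x P I i * (x P I o)⁻¹) * (x P I o * y P I o) := by
          simp [ofPolygon, mul_assoc]
      _ = _ := by rw [← h1, h.eq]; simp [ofPolygon, mul_assoc]
  · simp [ofPolygon, mul_assoc]
  · simp [ofPolygon, mul_assoc]

theorem ofPolygon_flipY (ho : P o o) (n : PolygonGroup P o) :
    ofPolygon I ho (flipY P o n) =
      invSnd I P (y P I o * ofPolygon I ho n * (y P I o)⁻¹) := by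
  suffices (ofPolygon I ho).comp (flipY P o).toMonoidHom = (invSnd I P).toMonoidHom.comp
      ((MulAut.conj (y P I o)).toMonoidHom.comp (ofPolygon I ho)) from DFunLike.congr_fun this n
  have h := (commute_xy (I := I) ho)
  refine PolygonGroup.hom_ext ?_ ?_ ?_ ?_ <;> intro i
  · simp [ofPolygon, mul_assoc]
  · simp [ofPolygon, mul_assoc]
  · simp [ofPolygon, mul_assoc]
  · have h1 : (x P I o)⁻¹ * (y P I o)⁻¹ = (y P I o)⁻¹ * (x P I o)⁻¹ := h.inv_inv.eq
    calc _ = (x P I o)⁻¹ * (y P I o)⁻¹ * (y P I i * (y P I o)⁻¹) * (y P I o * x P I o) := by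
          simp [ofPolygon, mul_assoc]
      _ = _ := by rw [h1, ← h.eq]; simp [ofPolygon, mul_assoc]

/-- The extension of `ofPolygon` to `Reflected`. -/
noncomputable def reflectedHom (I : Type*) [Zero I] (ho : P o o) : Reflected P o →* Inverted P I :=
  SemidirectProduct.lift (inl.comp (ofPolygon I ho))
    (RankTwo.lift (commute_inr_mul_inl (commute_xy ho) (invSnd_x _ _ _) (invFst_y _ _ _)))
    (SemidirectProduct.lift_compatible RankTwo.closure_eq_top (by
      rintro _ (rfl | rfl) n
      · simp only [flipAction_fst, RankTwo.lift_fst, MonoidHom.comp_apply]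
        rw [ofPolygon_flipX, eq_mul_inv_iff_mul_eq, ← mul_assoc, mul_assoc _ (inl _) (inl _),
          ← map_mul, conj_fst, mul_assoc _ (inr _) (inl _),
          conj_fst, ← mul_assoc, ← map_mul, ← map_mul, inv_mul_cancel_right]
      · simp only [flipAction_snd, RankTwo.lift_snd, MonoidHom.comp_apply]
        rw [ofPolygon_flipY, eq_mul_inv_iff_mul_eq, ← mul_assoc, mul_assoc _ (inl _) (inl _),
          ← map_mul, conj_snd, mul_assoc _ (inr _) (inl _),
          conj_snd, ← mul_assoc, ← map_mul, ← map_mul, inv_mul_cancel_right]))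

theorem reflectedHom_inl (ho : P o o) (n : PolygonGroup P o) :
    reflectedHom I ho (inl n) = inl (ofPolygon I ho n) := by simp [reflectedHom]

theorem reflectedHom_red (ho : P o o) (i : ι) :
    reflectedHom I ho (red P o i) = inr .fst * inl (x P I i) := by
  rw [conj_fst, red, map_mul, reflectedHom_inl]
  simp [reflectedHom, ofPolygon, conj_fst]

theorem reflectedHom_blue (ho : P o o) (i : ι) :
    reflectedHom I ho (blue P o i) = inr .snd * inl (y P I i) := by
  rw [conj_snd, blue, map_mul, reflectedHom_inl]
  simp [reflectedHom, ofPolygon, conj_snd]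

theorem right_reflectedHom (ho : P o o) (m : Reflected P o) :
    (reflectedHom I ho m).right = m.right := by
  suffices rightHom.comp (reflectedHom I ho) = rightHom from DFunLike.congr_fun this m
  refine SemidirectProduct.hom_ext ?_ (RankTwo.hom_ext ?_ ?_)
  · ext n
    simp [reflectedHom]
  · simp [reflectedHom]
  · simp [reflectedHom]

/-- The retraction onto `Reflected` killing the elements `s` and `t`. -/
def toReflected (I : Type*) [Zero I] (P : ι → ι → Prop) (o : ι) :
    ShiftArtin P I →* Reflected P o :=
  lift
    { x := red P o
      y := blue P o
      s := 1
      t := 1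
      s_zero := rfl
      t_zero := rfl
      commute_xy := fun _ _ h => commute_red_blue h
      commute_xt := fun _ _ => .one_right _
      commute_sy := fun _ _ => .one_left _
      commute_st := fun _ _ => .one_left _ }

theorem toReflected_ofPolygon (ho : P o o) (n : PolygonGroup P o) :
    toReflected I P o (ofPolygon I ho n) = inl n := by
  suffices (toReflected I P o).comp (ofPolygon I ho) = inl from DFunLike.congr_fun this n
  refine PolygonGroup.hom_ext ?_ ?_ ?_ ?_ <;> intro i <;>
    refine SemidirectProduct.ext ?_ ?_ <;>
    simp [ofPolygon, toReflected, red, blue]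

theorem ofPolygon_injective (ho : P o o) : Function.Injective (ofPolygon I ho) := fun a b h =>
  inl_injective (by rw [← toReflected_ofPolygon (I := I) ho a, h, toReflected_ofPolygon])

end Embedding

section Extensions

variable (I P o)

/-- The subgroup centralized by the first family of adjoined elements. -/
def redSubgroup : Subgroup (Reflected P o) := Subgroup.closure (Set.range (red P o))

/-- The first centralizing extension of `Reflected`. -/
abbrev Ext₁ : Type _ := CentralizingExt (redSubgroup P o) I

/-- The subgroup centralized by the second family of adjoined elements. -/
def blueSubgroup : Subgroup (Ext₁ I P o) :=
  Subgroup.closure (Set.range (fun i => inr (blue P o i)) ∪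
    Set.range (CentralizingExt.gen (redSubgroup P o)))

/-- The second centralizing extension of `Reflected`. -/
abbrev Ext₂ : Type _ := CentralizingExt (blueSubgroup I P o) I

variable {I P o}

theorem commute_red_gen (i : ι) (k : I) :
    Commute (inr (red P o i) : Ext₁ I P o) (CentralizingExt.gen _ k) :=
  CentralizingExt.commute_gen (Subgroup.subset_closure (Set.mem_range_self i)) k

theorem commute_blue_gen (i : ι) (k : I) :
    Commute (inr (inr (blue P o i)) : Ext₂ I P o) (CentralizingExt.gen _ k) :=
  CentralizingExt.commute_gen (Subgroup.subset_closure (.inl ⟨i, rfl⟩)) k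

theorem commute_gen_gen (k l : I) :
    Commute (inr (CentralizingExt.gen _ k) : Ext₂ I P o) (CentralizingExt.gen _ l) :=
  CentralizingExt.commute_gen (Subgroup.subset_closure (.inr ⟨k, rfl⟩)) l

end Extensions

section Rotation

variable [AddGroup I]

theorem rotHom_ofPolygon (ho : P o o) (c : I) (n : PolygonGroup P o) :
    rotHom P c (ofPolygon I ho n) = ofPolygon I ho n := by
  suffices (rotHom P c).comp (ofPolygon I ho) = ofPolygon I ho from DFunLike.congr_fun this n
  have h1 (a b : ι) : (x P I a)⁻¹ * s P c * ((s P c)⁻¹ * x P I b) = (x P I a)⁻¹ * x P I b := by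
    group
  have h2 (a b : ι) : (y P I a)⁻¹ * t P c * ((t P c)⁻¹ * y P I b) = (y P I a)⁻¹ * y P I b := by
    group
  have h3 (a : ι) : Commute ((x P I a)⁻¹ * x P I o) (t P c) :=
    (commute_xt a c).inv_left.mul_left (commute_xt o c)
  have h4 (a : ι) : Commute ((y P I a)⁻¹ * y P I o) (s P c) :=
    ((commute_sy c a).symm.inv_left.mul_left (commute_sy c o).symm)
  refine PolygonGroup.hom_ext ?_ ?_ ?_ ?_ <;> intro i <;>
    simp only [ofPolygon, MonoidHom.comp_apply, PolygonGroup.lift_x, PolygonGroup.lift_x',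
      PolygonGroup.lift_y, PolygonGroup.lift_y', map_mul, map_inv, rotHom_x, rotHom_y, mul_inv_rev,
      inv_inv, h1, h2]
  · rw [mul_assoc _ (t P c), ← (h3 i).eq]
    simp [mul_assoc]
  · rw [mul_assoc _ (s P c), ← (h4 i).eq]
    simp [mul_assoc]

variable (I P o)

/-- The shift of the adjoined elements of `Ext₁`. -/
def shift₁ (c : I) : Ext₁ I P o →* Ext₁ I P o :=
  CentralizingExt.lift inr (fun k => CentralizingExt.gen _ (c + k))
    fun _ hl _ => CentralizingExt.commute_gen hl _

theorem shift₁_inr (c : I) (m : Reflected P o) : shift₁ I P o c (inr m) = inr m := by simp [shift₁]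

theorem shift₁_gen (c k : I) : shift₁ I P o c (CentralizingExt.gen _ k) =
    CentralizingExt.gen _ (c + k) := by simp [shift₁]

theorem shift₁_mem (c : I) {l : Ext₁ I P o} (hl : l ∈ blueSubgroup I P o) :
    shift₁ I P o c l ∈ blueSubgroup I P o := by
  suffices blueSubgroup I P o ≤ (blueSubgroup I P o).comap (shift₁ I P o c) from this hl
  refine (Subgroup.closure_le _).2 ?_
  rintro _ (⟨i, rfl⟩ | ⟨k, rfl⟩)
  · exact Subgroup.subset_closure (.inl ⟨i, (shift₁_inr I P o c _).symm⟩)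
  · exact Subgroup.subset_closure (.inr ⟨c + k, (shift₁_gen I P o c k).symm⟩)

/-- The shift of the adjoined elements of `Ext₂`. -/
def shift₂ (c : I) : Ext₂ I P o →* Ext₂ I P o :=
  CentralizingExt.lift (inr.comp (shift₁ I P o c)) (fun k => CentralizingExt.gen _ (c + k))
    fun _ hl _ => CentralizingExt.commute_gen (shift₁_mem I P o c hl) _

theorem shift₂_inr (c : I) (m : Ext₁ I P o) :
    shift₂ I P o c (inr m) = inr (shift₁ I P o c m) := by simp [shift₂]

theorem shift₂_gen (c k : I) : shift₂ I P o c (CentralizingExt.gen _ k) =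
    CentralizingExt.gen _ (c + k) := by simp [shift₂]

variable {I P o} in
theorem exists_of_shift₂_eq {c : I} (hc : c ≠ 0) {e : Ext₂ I P o} (he : shift₂ I P o c e = e) :
    ∃ m : Reflected P o, e = inr (inr m) := by
  have hp : ∀ k, c + k ≠ k := by simpa using hc
  obtain ⟨m, hm, rfl⟩ := CentralizingExt.exists_of_fixed _ (fun _ => shift₁_mem I P o c) hp
    (shift₂_inr I P o c) (shift₂_gen I P o c) he
  obtain ⟨m, -, rfl⟩ := CentralizingExt.exists_of_fixed (φ := MonoidHom.id _) _ (fun _ => id) hp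
    (shift₁_inr I P o c) (shift₁_gen I P o c) hm
  exact ⟨m, rfl⟩

/-- The embedding of `ShiftArtin` into `Ext₂`. -/
def toExt : ShiftArtin P I →* Ext₂ I P o :=
  lift
    { x := fun i => (CentralizingExt.gen _ 0)⁻¹ * inr (inr (red P o i))
      y := fun i => inr (CentralizingExt.gen _ 0)⁻¹ * inr (inr (blue P o i))
      s := fun k => (CentralizingExt.gen _ 0)⁻¹ * CentralizingExt.gen _ k
      t := fun k => inr (CentralizingExt.gen _ 0)⁻¹ * inr (CentralizingExt.gen _ k)
      s_zero := by simp
      t_zero := by simp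
      commute_xy := fun i j h => by
        simp only [map_inv]
        refine ((commute_gen_gen _ _).symm.inv_inv.mul_right
          (commute_blue_gen _ _).symm.inv_left).mul_left (.mul_right ?_ ?_)
        · exact ((commute_red_gen _ _).map inr).inv_right
        · exact ((commute_red_blue h).map inr).map inr
      commute_xt := fun i l => by
        simp only [map_inv]
        refine ((commute_gen_gen _ _).symm.inv_inv.mul_right
          (commute_gen_gen _ _).symm.inv_left).mul_left (.mul_right ?_ ?_)
        · exact ((commute_red_gen _ _).map inr).inv_right
        · exact (commute_red_gen _ _).map inr
      commute_sy := fun k j => by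
        simp only [map_inv]
        exact ((commute_gen_gen _ _).symm.inv_inv.mul_right
          (commute_blue_gen _ _).symm.inv_left).mul_left
          ((commute_gen_gen _ _).symm.inv_right.mul_right (commute_blue_gen _ _).symm)
      commute_st := fun k l => by
        simp only [map_inv]
        exact ((commute_gen_gen _ _).symm.inv_inv.mul_right
          (commute_gen_gen _ _).symm.inv_left).mul_left
          ((commute_gen_gen _ _).symm.inv_right.mul_right (commute_gen_gen _ _).symm) }

theorem shift₂_toExt (c : I) (a : ShiftArtin P I) :
    shift₂ I P o c (toExt I P o a) = toExt I P o (rotHom P c a) := by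
  suffices (shift₂ I P o c).comp (toExt I P o) = (toExt I P o).comp (rotHom P c) from
    DFunLike.congr_fun this a
  refine hom_ext ?_ ?_ ?_ ?_ <;> intro i <;>
    simp [toExt, shift₂_inr, shift₂_gen, shift₁_inr, shift₁_gen, mul_assoc]

variable {P o}

/-- The extension of `reflectedHom` to `Ext₁`. -/
noncomputable def ext₁Hom (ho : P o o) : Ext₁ I P o →* Inverted P I :=
  CentralizingExt.lift (reflectedHom I ho) (fun k => inr .snd * inl (t P k))
    fun _ hl k => Subgroup.forall_commute_of_closure (by
      rintro _ ⟨i, rfl⟩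
      rw [reflectedHom_red]
      exact commute_inr_mul_inl (commute_xt _ _) (by simp) (by simp)) hl

/-- The extension of `ext₁Hom` to `Ext₂`. -/
noncomputable def ext₂Hom (ho : P o o) : Ext₂ I P o →* Inverted P I :=
  CentralizingExt.lift (ext₁Hom I ho) (fun k => inr .fst * inl (s P k))
    fun _ hl k => Subgroup.forall_commute_of_closure (by
      rintro _ (⟨i, rfl⟩ | ⟨l, rfl⟩)
      · rw [ext₁Hom, CentralizingExt.lift_inr, reflectedHom_blue]
        exact (commute_inr_mul_inl (commute_sy _ _) (by simp) (by simp)).symm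
      · rw [ext₁Hom, CentralizingExt.lift_gen]
        exact (commute_inr_mul_inl (commute_st _ _) (by simp) (by simp)).symm) hl

theorem ext₂Hom_inr_inr (ho : P o o) (m : Reflected P o) :
    ext₂Hom I ho (inr (inr m)) = reflectedHom I ho m := by
  simp [ext₂Hom, ext₁Hom]

theorem ext₂Hom_toExt (ho : P o o) (a : ShiftArtin P I) :
    ext₂Hom I ho (toExt I P o a) = inl a := by
  suffices (ext₂Hom I ho).comp (toExt I P o) = inl from DFunLike.congr_fun this a
  refine hom_ext ?_ ?_ ?_ ?_ <;> intro i
  · simp [toExt, ext₂Hom_inr_inr, reflectedHom_red]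
    simp [ext₂Hom]
  · simp [toExt, ext₂Hom_inr_inr, reflectedHom_blue]
    simp [ext₂Hom, ext₁Hom]
  · simp [toExt, ext₂Hom, ext₁Hom]
  · simp [toExt, ext₂Hom, ext₁Hom]

variable {I}

theorem mem_range_ofPolygon (ho : P o o) {c : I} (hc : c ≠ 0) {a : ShiftArtin P I}
    (ha : rotHom P c a = a) : ∃ n, ofPolygon I ho n = a := by
  obtain ⟨m, hm⟩ := exists_of_shift₂_eq hc (e := toExt I P o a) (by rw [shift₂_toExt, ha])
  have h1 : inl a = reflectedHom I ho m := by
    rw [← ext₂Hom_toExt I ho, hm, ext₂Hom_inr_inr]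
  have h2 : m.right = 1 := by
    rw [← right_reflectedHom (I := I) ho, ← h1, right_inl]
  have h3 : m = inl m.left := by
    rw [← inl_left_mul_inr_right m, h2]
    simp
  rw [h3, reflectedHom_inl] at h1
  exact ⟨_, (inl_injective h1).symm⟩

/-- The fixed subgroup of a nontrivial rotation. -/
noncomputable def fixEquiv (ho : P o o) {c : I} (hc : c ≠ 0) :
    fixSubgroup (rot P (.ofAdd c)) ≃* PolygonGroup P o :=
  (MulEquiv.ofBijective ((ofPolygon I ho).codRestrict (fixSubgroup (rot P (.ofAdd c)))
    fun n => rotHom_ofPolygon ho c n)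
    ⟨fun _ _ h => ofPolygon_injective ho (congrArg Subtype.val h),
      fun ⟨_, ha⟩ => (mem_range_ofPolygon ho hc ha).imp fun _ h => Subtype.ext h⟩).symm

end Rotation

end ShiftArtin

/-- The relation on `Fin (g + 1)` describing the adjacencies between the colors of an alternately
colored cycle of length `2 * (g + 1)`. -/
def cycleRel (g : ℕ) (i j : Fin (g + 1)) : Prop := j = i ∨ j = i + 1

theorem cycleRel_self {g : ℕ} (i : Fin (g + 1)) : cycleRel g i i := .inl rfl

theorem cycleRel_ofNat_succ (g n : ℕ) :
    cycleRel g (Fin.ofNat (g + 1) n) (Fin.ofNat (g + 1) (n + 1)) :=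
  .inr (by ext; simp [Fin.val_add])

theorem cycleRel.val_eq {g : ℕ} {i j : Fin (g + 1)} (h : cycleRel g i j) :
    (j : ℕ) = i ∨ (j : ℕ) = i + 1 ∨ ((i : ℕ) = g ∧ (j : ℕ) = 0) := by
  rcases h with rfl | rfl
  · exact .inl rfl
  · rcases (Fin.le_last i).lt_or_eq with h | rfl
    · exact .inr (.inl (Fin.val_add_one_of_lt h))
    · exact .inr (.inr ⟨rfl, by simp⟩)

namespace SurfaceGroup

variable {G H : Type*} [Group G] [Group H]

/-- The product of the commutators of `a k` and `b k` for `k < n`. -/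
def commProd (a b : ℕ → G) (n : ℕ) : G :=
  ((List.range n).map fun k => a k * b k * (a k)⁻¹ * (b k)⁻¹).prod

theorem commProd_zero (a b : ℕ → G) : commProd a b 0 = 1 := rfl

theorem commProd_succ (a b : ℕ → G) (n : ℕ) :
    commProd a b (n + 1) = commProd a b n * (a n * b n * (a n)⁻¹ * (b n)⁻¹) :=
  List.prod_range_succ _ _

theorem map_commProd (f : G →* H) {a b : ℕ → G} {a' b' : ℕ → H} {n : ℕ}
    (ha : ∀ k < n, f (a k) = a' k) (hb : ∀ k < n, f (b k) = b' k) :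
    f (commProd a b n) = commProd a' b' n := by
  rw [commProd, commProd, map_list_prod, List.map_map]
  congr 1
  refine List.map_congr_left fun k hk => ?_
  simp [ha k (List.mem_range.1 hk), hb k (List.mem_range.1 hk)]

/-- The product of the elements `b k` for `k < n`, in descending order. -/
def descProd (b : ℕ → G) : ℕ → G
  | 0 => 1
  | n + 1 => b n * descProd b n

theorem map_descProd (f : G →* H) {b : ℕ → G} {b' : ℕ → H} {n : ℕ}
    (hb : ∀ k < n, f (b k) = b' k) : f (descProd b n) = descProd b' n := by
  induction n with
  | zero => exact map_one f
  | succ n ih => simp [descProd, ih fun k hk => hb k (by omega), hb n (by omega)]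

/-- The values of the generators `y⁻¹` of the polygon group in terms of standard generators of the
surface group. -/
def yInv (a b : ℕ → G) : ℕ → G
  | 0 => 1
  | n + 1 => (descProd b n)⁻¹ * a n * descProd b n

theorem map_yInv (f : G →* H) {a b : ℕ → G} {a' b' : ℕ → H} {n : ℕ}
    (ha : ∀ k < n, f (a k) = a' k) (hb : ∀ k < n, f (b k) = b' k) :
    f (yInv a b n) = yInv a' b' n := by
  cases n with
  | zero => exact map_one f
  | succ n =>
    have h := map_descProd f (n := n) fun k hk => hb k (by omega)
    simp [yInv, h, ha n (by omega)]

/-- The values of the inverses of the generators `y'` of the polygon group in terms of standard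
generators of the surface group. -/
def yInv' (a b : ℕ → G) : ℕ → G
  | 0 => 1
  | n + 1 => commProd a b n * a n

theorem map_yInv' (f : G →* H) {a b : ℕ → G} {a' b' : ℕ → H} {n : ℕ}
    (ha : ∀ k < n, f (a k) = a' k) (hb : ∀ k < n, f (b k) = b' k) :
    f (yInv' a b n) = yInv' a' b' n := by
  cases n with
  | zero => exact map_one f
  | succ n =>
    have h := map_commProd f (n := n) (fun k hk => ha k (by omega)) fun k hk => hb k (by omega)
    simp [yInv', h, ha n (by omega)]

/-- Extend a family indexed by `Fin g` by the value `1`. -/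
def extendNat {g : ℕ} (u : Fin g → G) (n : ℕ) : G := if h : n < g then u ⟨n, h⟩ else 1

@[simp]
theorem extendNat_val {g : ℕ} (u : Fin g → G) (i : Fin g) : extendNat u i = u i := by
  simp [extendNat]

theorem map_surfaceRel {g : ℕ} (f : FreeGroup (Fin g ⊕ Fin g) →* G) (a b : ℕ → G)
    (ha : ∀ i : Fin g, f (.of (.inl i)) = a i) (hb : ∀ i : Fin g, f (.of (.inr i)) = b i) :
    f (surfaceRel g) = commProd a b g := by
  rw [surfaceRel, commProd, ← List.map_coe_finRange_eq_range, map_list_prod, List.map_map,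
    List.map_map]
  simp [Function.comp_def, ha, hb]

variable (g : ℕ)

/-- The generators `a`, extended by `1`. -/
def a : ℕ → SurfaceGroup g := extendNat fun i => PresentedGroup.of (.inl i)

/-- The generators `b`, extended by `1`. -/
def b : ℕ → SurfaceGroup g := extendNat fun i => PresentedGroup.of (.inr i)

theorem commProd_eq_one : commProd (a g) (b g) g = 1 := by
  rw [← map_surfaceRel (PresentedGroup.mk _) (a g) (b g)
    (fun i => by rw [a, extendNat_val]; rfl) (fun i => by rw [b, extendNat_val]; rfl)]
  exact PresentedGroup.one_of_mem rfl

variable {g}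

/-- The universal property of the surface group. -/
def lift (a b : ℕ → G) (h : commProd a b g = 1) : SurfaceGroup g →* G :=
  PresentedGroup.toGroup (rels := {surfaceRel g})
    (f := Sum.elim (fun i : Fin g => a i) (fun i : Fin g => b i)) (by
    rintro _ rfl
    rw [map_surfaceRel _ a b (by simp) (by simp), h])

theorem lift_a (u v : ℕ → G) (h : commProd u v g = 1) {n : ℕ} (hn : n < g) :
    lift u v h (a g n) = u n := by
  simp only [a, extendNat, hn, dif_pos]
  exact PresentedGroup.toGroup.of _

theorem lift_b (u v : ℕ → G) (h : commProd u v g = 1) {n : ℕ} (hn : n < g) :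
    lift u v h (b g n) = v n := by
  simp only [b, extendNat, hn, dif_pos]
  exact PresentedGroup.toGroup.of _

theorem hom_ext {f₁ f₂ : SurfaceGroup g →* G} (ha : ∀ n < g, f₁ (a g n) = f₂ (a g n))
    (hb : ∀ n < g, f₁ (b g n) = f₂ (b g n)) : f₁ = f₂ :=
  PresentedGroup.ext (by
    rintro (i | i)
    · simpa [a] using ha i i.2
    · simpa [b] using hb i i.2)

/-- The map from the polygon group to the surface group. -/
def ofPolygon (g : ℕ) : PolygonGroup (cycleRel g) 0 →* SurfaceGroup g :=
  PolygonGroup.lift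
    { x := fun i => (descProd (b g) i)⁻¹
      x' := fun i => (commProd (a g) (b g) i * descProd (b g) i)⁻¹
      y := fun i => (yInv (a g) (b g) i)⁻¹
      y' := fun i => (yInv' (a g) (b g) i)⁻¹
      x_base := by simp [descProd]
      x'_base := by simp [descProd, commProd_zero]
      y_base := by simp [yInv]
      y'_base := by simp [yInv']
      relation := fun i j h => by
        rcases h.val_eq with h | h | ⟨h, h'⟩
        · rw [h]
          cases (i : ℕ) with
          | zero => simp [descProd, commProd_zero, yInv, yInv']
          | succ n => simp [descProd, commProd_succ, yInv, yInv', mul_assoc]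
        · rw [h]
          simp [yInv, yInv', mul_assoc]
        · rw [h, h', commProd_eq_one]
          simp [yInv, yInv'] }

section

open PolygonGroup

/-- The generators `x` of the polygon group, indexed by natural numbers. -/
def px (g n : ℕ) : PolygonGroup (cycleRel g) 0 := x _ _ (Fin.ofNat (g + 1) n)

/-- The generators `x'` of the polygon group, indexed by natural numbers. -/
def px' (g n : ℕ) : PolygonGroup (cycleRel g) 0 := x' _ _ (Fin.ofNat (g + 1) n)

/-- The generators `y` of the polygon group, indexed by natural numbers. -/
def py (g n : ℕ) : PolygonGroup (cycleRel g) 0 := y _ _ (Fin.ofNat (g + 1) n)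

/-- The generators `y'` of the polygon group, indexed by natural numbers. -/
def py' (g n : ℕ) : PolygonGroup (cycleRel g) 0 := y' _ _ (Fin.ofNat (g + 1) n)

theorem relation_self (g n : ℕ) : px g n * py' g n = py g n * px' g n := relation (cycleRel_self _)

theorem relation_succ (g n : ℕ) : px g n * py' g (n + 1) = py g (n + 1) * px' g n :=
  relation (cycleRel_ofNat_succ g n)

/-- The values of the generators `a` of the surface group in the polygon group. -/
def pa (g n : ℕ) : PolygonGroup (cycleRel g) 0 := (px g n)⁻¹ * (py g (n + 1))⁻¹ * px g n

/-- The values of the generators `b` of the surface group in the polygon group. -/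
def pb (g n : ℕ) : PolygonGroup (cycleRel g) 0 := (px g (n + 1))⁻¹ * px g n

theorem descProd_pb (g n : ℕ) : descProd (pb g) n = (px g n)⁻¹ := by
  induction n with
  | zero => simp [descProd, px]
  | succ n ih => simp [descProd, ih, pb]

theorem commProd_pa_pb (g n : ℕ) : commProd (pa g) (pb g) n = (px' g n)⁻¹ * px g n := by
  induction n with
  | zero => simp [commProd_zero, px, px']
  | succ n ih =>
    have h1 : (px' g n)⁻¹ * (py g (n + 1))⁻¹ = (py' g (n + 1))⁻¹ * (px g n)⁻¹ := by
      rw [← mul_inv_rev, ← mul_inv_rev, relation_succ]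
    have h2 : (px' g (n + 1))⁻¹ * (py g (n + 1))⁻¹ = (py' g (n + 1))⁻¹ * (px g (n + 1))⁻¹ := by
      rw [← mul_inv_rev, ← mul_inv_rev, relation_self]
    calc _ = (px' g n)⁻¹ * (py g (n + 1))⁻¹ * px g n * (px g (n + 1))⁻¹ * py g (n + 1) *
          px g (n + 1) := by
          rw [commProd_succ, ih, pa, pb]; group
      _ = (py' g (n + 1))⁻¹ * (px g (n + 1))⁻¹ * py g (n + 1) * px g (n + 1) := by
          rw [h1]; group
      _ = _ := by rw [← h2]; group

theorem yInv_pa_pb (g n : ℕ) : yInv (pa g) (pb g) n = (py g n)⁻¹ := by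
  cases n with
  | zero => simp [yInv, py]
  | succ n => simp [yInv, descProd_pb, pa, mul_assoc]

theorem yInv'_pa_pb (g n : ℕ) : yInv' (pa g) (pb g) n = (py' g n)⁻¹ := by
  cases n with
  | zero => simp [yInv', py']
  | succ n =>
    rw [eq_inv_iff_mul_eq_one]
    simp [yInv', commProd_pa_pb, pa, mul_assoc, relation_succ]

theorem commProd_pa_pb_eq_one (g : ℕ) : commProd (pa g) (pb g) g = 1 := by
  have h := relation (o := 0) (cycleRel_ofNat_succ g g)
  have h0 : Fin.ofNat (g + 1) (g + 1) = 0 := by ext; simp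
  rw [h0, y'_base, y_base, mul_one, one_mul] at h
  rw [commProd_pa_pb, px, px', h, inv_mul_cancel]

/-- The map from the surface group to the polygon group. -/
def toPolygon (g : ℕ) : SurfaceGroup g →* PolygonGroup (cycleRel g) 0 :=
  lift (pa g) (pb g) (commProd_pa_pb_eq_one g)

theorem toPolygon_a {k : ℕ} (hk : k < g) : toPolygon g (a g k) = pa g k := lift_a _ _ _ hk

theorem toPolygon_b {k : ℕ} (hk : k < g) : toPolygon g (b g k) = pb g k := lift_b _ _ _ hk

theorem toPolygon_comp_ofPolygon (g : ℕ) :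
    (toPolygon g).comp (ofPolygon g) = MonoidHom.id _ := by
  have ha (i : Fin (g + 1)) (k : ℕ) (hk : k < i) : toPolygon g (a g k) = pa g k :=
    toPolygon_a (by omega)
  have hb (i : Fin (g + 1)) (k : ℕ) (hk : k < i) : toPolygon g (b g k) = pb g k :=
    toPolygon_b (by omega)
  refine PolygonGroup.hom_ext ?_ ?_ ?_ ?_ <;> intro i
  · simp [ofPolygon, map_descProd _ (hb i), descProd_pb, px]
  · simp [ofPolygon, map_descProd _ (hb i), map_commProd _ (ha i) (hb i), descProd_pb,
      commProd_pa_pb, px']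
  · simp [ofPolygon, map_yInv _ (ha i) (hb i), yInv_pa_pb, py]
  · simp [ofPolygon, map_yInv' _ (ha i) (hb i), yInv'_pa_pb, py']

theorem ofPolygon_comp_toPolygon (g : ℕ) :
    (ofPolygon g).comp (toPolygon g) = MonoidHom.id _ := by
  have hmod {n : ℕ} (hn : n < g) : n % (g + 1) = n := Nat.mod_eq_of_lt (by omega)
  have hmod' {n : ℕ} (hn : n < g) : (n + 1) % (g + 1) = n + 1 := Nat.mod_eq_of_lt (by omega)
  refine hom_ext ?_ ?_ <;> intro n hn
  · simp [toPolygon_a hn, pa, px, py, ofPolygon, hmod hn, hmod' hn, yInv, mul_assoc]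
  · simp [toPolygon_b hn, pb, px, ofPolygon, hmod hn, hmod' hn, descProd]

end

/-- The surface group is the polygon group of an alternately colored cycle. -/
def polygonEquiv (g : ℕ) : PolygonGroup (cycleRel g) 0 ≃* SurfaceGroup g :=
  (ofPolygon g).toMulEquiv (toPolygon g) (toPolygon_comp_ofPolygon g) (ofPolygon_comp_toPolygon g)

end SurfaceGroup

/-- Conjugate automorphisms have isomorphic fixed subgroups. -/
def fixSubgroupCongr {G H : Type*} [Group G] [Group H] (e : G ≃* H) (φ : MulAut G) :
    fixSubgroup (MulAut.congr e φ) ≃* fixSubgroup φ where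
  toFun a := ⟨e.symm a, (e.symm_apply_apply _).symm.trans (congrArg e.symm a.2)⟩
  invFun a := ⟨e a, show e (φ (e.symm (e a))) = e a by
    rw [e.symm_apply_apply, show φ a = a from a.2]⟩
  left_inv a := by simp
  right_inv a := by simp
  map_mul' a b := Subtype.ext (map_mul e.symm _ _)

/-- Every right-angled Artin group of a finite graph is one on vertex set `Fin n`; automorphisms
and their fixed subgroups are transported. -/
theorem exists_fin_raag {V H : Type*} [Finite V] [Group H] {Λ : SimpleGraph V}
    (φ : MulAut (RAAG Λ)) (e : fixSubgroup φ ≃* H) :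
    ∃ (n : ℕ) (Δ : SimpleGraph (Fin n)) (ψ : MulAut (RAAG Δ)),
      orderOf ψ = orderOf φ ∧ Nonempty (fixSubgroup ψ ≃* H) :=
  let c := RAAG.congr (SimpleGraph.Iso.map (Finite.equivFin V) Λ)
  ⟨_, _, MulAut.congr c φ, (MulAut.congr c).orderOf_eq φ, ⟨(fixSubgroupCongr c φ).trans e⟩⟩

/-- For every `g ≥ 1` and every `N ≥ 2`, some right-angled Artin group on a
finite simple graph admits an automorphism of order exactly `N` (so in particular
`φ^N = id`) whose fixed subgroup is isomorphic to the genus-`g` surface group. -/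
theorem surface_group_is_fixed_subgroup_of_order_N (g : ℕ) (hg : 1 ≤ g)
    (N : ℕ) (hN : 2 ≤ N) :
    ∃ (n : ℕ) (Λ : SimpleGraph (Fin n)) (φ : MulAut (RAAG Λ)),
      orderOf φ = N ∧
      Nonempty (fixSubgroup (φ : RAAG Λ ≃* RAAG Λ) ≃* SurfaceGroup g) := by

  have : NeZero N := ⟨by omega⟩
  have : Fact (1 < N) := ⟨hN⟩
  let φ := ShiftArtin.rot (I := ZMod N) (cycleRel g) (.ofAdd 1)
  have hφ : orderOf φ = N := by
    rw [orderOf_injective _ (ShiftArtin.rot_injective _), orderOf_ofAdd_eq_addOrderOf,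
      ZMod.addOrderOf_one]
  obtain ⟨n, Λ, ψ, hψ, e⟩ := exists_fin_raag φ
    ((ShiftArtin.fixEquiv (cycleRel_self 0) one_ne_zero).trans (SurfaceGroup.polygonEquiv g))
  exact ⟨n, Λ, ψ, hψ.trans hφ, e⟩
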